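/- arXiv:1112.0217 — 3 statements merged into one kernel-verified Lean document; each statement's English description precedes it below -/
import Mathlib

section
/- If M ∈ ℝ^{n×n} is a P-matrix, then the basis matrix M̄_B is invertible for every set B ⊆ [n]. -/
open Matrix

/-- The basis matrix `M̄_B`: column `j` is the `j`-th column of `-M` if `j ∈ B`,
and the `j`-th column of the identity matrix otherwise. -/
def basisMatrix {ι : Type*} [Fintype ι] [DecidableEq ι]
    (M : Matrix ι ι ℝ) (B : Finset ι) : Matrix ι ι ℝ :=
  fun i j => if j ∈ B then -M i j else if i = j then 1 else 0

/-- A P-matrix: every principal minor is positive. -/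
def IsPMatrix {ι : Type*} [Fintype ι] [DecidableEq ι] (M : Matrix ι ι ℝ) : Prop :=
  ∀ K : Finset ι, 0 < (M.submatrix (fun i : K => i.1) (fun j : K => j.1)).det

/-- The vector `w(B)` of the complementary pair. -/
noncomputable def wvec {ι : Type*} [Fintype ι] [DecidableEq ι]
    (M : Matrix ι ι ℝ) (q : ι → ℝ) (B : Finset ι) : ι → ℝ :=
  fun i => if i ∈ B then 0 else ((basisMatrix M B)⁻¹ *ᵥ q) i

/-- The vector `z(B)` of the complementary pair. -/
noncomputable def zvec {ι : Type*} [Fintype ι] [DecidableEq ι]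
    (M : Matrix ι ι ℝ) (q : ι → ℝ) (B : Finset ι) : ι → ℝ :=
  fun i => if i ∈ B then ((basisMatrix M B)⁻¹ *ᵥ q) i else 0

/-- `(w, z)` solves the linear complementarity problem LCP(M,q). -/
def SolvesLCP {ι : Type*} [Fintype ι] (M : Matrix ι ι ℝ) (q w z : ι → ℝ) : Prop :=
  w - M *ᵥ z = q ∧ (∀ i, 0 ≤ w i) ∧ (∀ i, 0 ≤ z i) ∧ w ⬝ᵥ z = 0

/-- `B` is an optimal basis for LCP(M,q). -/
noncomputable def OptimalBasis {ι : Type*} [Fintype ι] [DecidableEq ι]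
    (M : Matrix ι ι ℝ) (q : ι → ℝ) (B : Finset ι) : Prop :=
  SolvesLCP M q (wvec M q B) (zvec M q B)

/-- LCP(M,q) is nondegenerate. -/
def Nondeg {ι : Type*} [Fintype ι] [DecidableEq ι] (M : Matrix ι ι ℝ) (q : ι → ℝ) : Prop :=
  ∀ B : Finset ι, ∀ i, ((basisMatrix M B)⁻¹ *ᵥ q) i ≠ 0

/-- `M` is lower Hessenberg: `m_{ij} = 0` whenever `j - i > 1`. -/
def LowerHessenberg {k : ℕ} (M : Matrix (Fin k) (Fin k) ℝ) : Prop :=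
  ∀ i j : Fin k, (i : ℕ) + 1 < (j : ℕ) → M i j = 0

/-- `M` is upper Hessenberg: `m_{ij} = 0` whenever `i - j > 1`. -/
def UpperHessenberg {k : ℕ} (M : Matrix (Fin k) (Fin k) ℝ) : Prop :=
  ∀ i j : Fin k, (j : ℕ) + 1 < (i : ℕ) → M i j = 0

/-- Up to sign, the determinant of a basis matrix is the principal minor indexed by the basis. -/
theorem det_basisMatrix {ι : Type*} [Fintype ι] [DecidableEq ι] (M : Matrix ι ι ℝ)
    (B : Finset ι) :
    (basisMatrix M B).det =
      (-1) ^ B.card * (M.submatrix (fun i : B => i.1) (fun j : B => j.1)).det := by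
  have hzero : ∀ i, i ∈ B → ∀ j, j ∉ B → basisMatrix M B i j = 0 := by
    intro i hi j hj
    have hij : i ≠ j := fun h => hj (h ▸ hi)
    simp [basisMatrix, hj, hij]
  have hmem : toSquareBlockProp (basisMatrix M B) (fun i => i ∈ B) =
      -M.submatrix (fun i : B => i.1) (fun j : B => j.1) := by
    ext i j
    simp [toSquareBlockProp_def, basisMatrix]
  have hnotMem : toSquareBlockProp (basisMatrix M B) (fun i => ¬ i ∈ B) = 1 := by
    ext i j
    simp [toSquareBlockProp_def, basisMatrix, j.2, one_apply, Subtype.ext_iff]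
  rw [twoBlockTriangular_det' _ (fun i => i ∈ B) hzero, hmem, hnotMem, det_one, mul_one]
  rw [← Fintype.card_coe B]
  convert det_neg (M.submatrix (fun i : B => i.1) (fun j : B => j.1))

/-- for a P-matrix `M`, every basis matrix `M̄_B` is invertible. -/
theorem stmt_1 (n : ℕ) (M : Matrix (Fin n) (Fin n) ℝ) (hM : IsPMatrix M)
    (B : Finset (Fin n)) : IsUnit (basisMatrix M B) := by
  rw [isUnit_iff_isUnit_det, det_basisMatrix, isUnit_iff_ne_zero]
  exact mul_ne_zero (pow_ne_zero _ (by norm_num)) (hM B).ne'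
end

section
/- Let M ∈ ℝ^{n×n} be a P-matrix, q ∈ ℝⁿ, K ⊆ [n], and B ⊆ K. Then the restriction of the vector M̄_B⁻¹ q to the coordinates in K equals (M_{KK})̄_B⁻¹ q_K, where (M_{KK})̄_B is the basis matrix of M_{KK} associated with B. -/
open Matrix

section BasisMatrix

variable {ι : Type*} [Fintype ι] [DecidableEq ι]

theorem basisMatrix_apply_eq_zero (M : Matrix ι ι ℝ) {K B : Finset ι} (hBK : B ⊆ K)
    {i j : ι} (hi : i ∈ K) (hj : j ∉ K) : basisMatrix M B i j = 0 := by
  have hij : i ≠ j := fun h => hj (h ▸ hi)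
  have hjB : j ∉ B := fun h => hj (hBK h)
  simp [basisMatrix, hij, hjB]

theorem basisMatrix_submatrix (M : Matrix ι ι ℝ) (K B : Finset ι) :
    basisMatrix (M.submatrix (fun i : K => i.1) (fun j : K => j.1))
        (Finset.univ.filter (fun j : K => j.1 ∈ B)) =
      (basisMatrix M B).submatrix (fun i : K => i.1) (fun j : K => j.1) := by
  ext i j
  simp only [basisMatrix, submatrix_apply, Finset.mem_filter, Finset.mem_univ, true_and,
    Subtype.ext_iff]

theorem det_basisMatrix_submatrix (M : Matrix ι ι ℝ) {K B : Finset ι} (hBK : B ⊆ K) :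
    ((basisMatrix M B).submatrix (fun i : K => i.1) (fun j : K => j.1)).det =
      (basisMatrix M B).det := by
  rw [twoBlockTriangular_det' (basisMatrix M B) (· ∈ K)
    fun i hi j hj => basisMatrix_apply_eq_zero M hBK hi hj]
  have hone : toSquareBlockProp (basisMatrix M B) (fun i => ¬ i ∈ K) = 1 := by
    ext i j
    have hj : j.1 ∉ B := fun h => j.2 (hBK h)
    simp [toSquareBlockProp_def, basisMatrix, hj, one_apply, Subtype.ext_iff]
  rw [hone, det_one, mul_one]
  convert rfl using 2
  rfl

theorem IsPMatrix.det_basisMatrix_ne_zero {M : Matrix ι ι ℝ} (hM : IsPMatrix M)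
    (B : Finset ι) : (basisMatrix M B).det ≠ 0 := by
  have hneg : (basisMatrix M B).submatrix (fun i : B => i.1) (fun j : B => j.1) =
      -M.submatrix (fun i : B => i.1) (fun j : B => j.1) := by
    ext i j
    simp [basisMatrix]
  rw [← det_basisMatrix_submatrix M (Finset.Subset.refl B), hneg, det_neg]
  exact mul_ne_zero (pow_ne_zero _ (by norm_num)) (hM B).ne'

theorem basisMatrix_submatrix_mulVec (M : Matrix ι ι ℝ) {K B : Finset ι} (hBK : B ⊆ K)
    (x : ι → ℝ) :
    (basisMatrix M B).submatrix (fun i : K => i.1) (fun j : K => j.1) *ᵥ (fun j : K => x j.1) =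
      fun i : K => (basisMatrix M B *ᵥ x) i.1 := by
  ext i
  simp only [mulVec, dotProduct, submatrix_apply]
  rw [Finset.sum_coe_sort K (fun j => basisMatrix M B i.1 j * x j)]
  refine Finset.sum_subset (Finset.subset_univ K) fun j _ hj => ?_
  rw [basisMatrix_apply_eq_zero M hBK i.2 hj, zero_mul]

end BasisMatrix

/-- for a P-matrix `M`, `K ⊆ [n]` and `B ⊆ K`, the restriction of
`M̄_B⁻¹ q` to the coordinates in `K` equals `(M_{KK})̄_B⁻¹ q_K`. -/
theorem stmt_6 (n : ℕ) (M : Matrix (Fin n) (Fin n) ℝ) (hM : IsPMatrix M)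
    (q : Fin n → ℝ) (K B : Finset (Fin n)) (hBK : B ⊆ K) :
    ∀ i : K,
      ((basisMatrix M B)⁻¹ *ᵥ q) i.1 =
        ((basisMatrix (M.submatrix (fun i : K => i.1) (fun j : K => j.1))
            (Finset.univ.filter (fun j : K => j.1 ∈ B)))⁻¹
          *ᵥ (fun j : K => q j.1)) i := by
  intro i
  have hdet := hM.det_basisMatrix_ne_zero B
  rw [basisMatrix_submatrix]
  have hx : basisMatrix M B *ᵥ ((basisMatrix M B)⁻¹ *ᵥ q) = q := by
    rw [mulVec_mulVec, mul_nonsing_inv _ hdet.isUnit, one_mulVec]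
  have hres := basisMatrix_submatrix_mulVec M hBK ((basisMatrix M B)⁻¹ *ᵥ q)
  rw [hx] at hres
  rw [← hres, mulVec_mulVec, nonsing_inv_mul, one_mulVec]
  rw [det_basisMatrix_submatrix M hBK]
  exact hdet.isUnit
end

section
/- Let M ∈ ℝ^{n×n} be a lower Hessenberg P-matrix and q ∈ ℝⁿ such that LCP(M,q) is nondegenerate. Then for every k ∈ [n] there exists an index ℓ ∈ {−1, 0, …, k−1} such that B(k) = B(ℓ) ∪ {ℓ+2, ℓ+3, …, k}. -/
open Matrix

/-- The principal minor on `K`, as a determinant in which the rows outside `K` are unit rows. -/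
theorem IsPMatrix.det_ite_row_pos {ι : Type*} [Fintype ι] [DecidableEq ι] {M : Matrix ι ι ℝ}
    (hM : IsPMatrix M) (K : Finset ι) :
    0 < (Matrix.of fun i => if i ∈ K then M i else Pi.single i 1 : Matrix ι ι ℝ).det := by
  have hzero : ∀ i, ¬ i ∈ K → ∀ j, j ∈ K →
      (Matrix.of fun i => if i ∈ K then M i else Pi.single i 1 : Matrix ι ι ℝ) i j = 0 := by
    intro i hi j hj
    have hij : j ≠ i := fun h => hi (h ▸ hj)
    simp [hi, hij]
  rw [Matrix.twoBlockTriangular_det _ (· ∈ K) hzero]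
  have hone : Matrix.toSquareBlockProp
      (Matrix.of fun i => if i ∈ K then M i else Pi.single i 1 : Matrix ι ι ℝ)
      (fun i => ¬ i ∈ K) = 1 := by
    ext i j
    simp [Matrix.toSquareBlockProp, i.2, Matrix.one_apply, Pi.single_apply, Subtype.ext_iff,
      eq_comm]
  have hblock : Matrix.toSquareBlockProp
      (Matrix.of fun i => if i ∈ K then M i else Pi.single i 1 : Matrix ι ι ℝ)
      (· ∈ K) = M.submatrix (fun i : K => i.1) (fun j : K => j.1) := by
    ext i j
    simp [Matrix.toSquareBlockProp]
  rw [hone, hblock, Matrix.det_one, mul_one]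
  convert hM K

/-- Adding a nonnegative diagonal to a P-matrix keeps its principal minors positive. -/
theorem IsPMatrix.det_add_diagonal_pos {ι : Type*} [Fintype ι] [DecidableEq ι] {M : Matrix ι ι ℝ}
    (hM : IsPMatrix M) {d : ι → ℝ} (hd : ∀ i, 0 ≤ d i) (S K : Finset ι) :
    0 < (Matrix.of fun i => if i ∈ K then M i + (if i ∈ S then d i • Pi.single i 1 else 0)
      else Pi.single i 1 : Matrix ι ι ℝ).det := by
  induction S using Finset.induction_on generalizing K with
  | empty => simpa using hM.det_ite_row_pos K
  | insert a S ha ih =>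
    set A : Finset ι → Matrix ι ι ℝ := fun K => Matrix.of fun i =>
      if i ∈ K then M i + (if i ∈ S then d i • Pi.single i 1 else 0) else Pi.single i 1 with hA
    by_cases haK : a ∈ K
    · have hsplit : (Matrix.of fun i => if i ∈ K then
          M i + (if i ∈ insert a S then d i • Pi.single i 1 else 0)
          else Pi.single i 1 : Matrix ι ι ℝ) =
          (A K).updateRow a (M a + d a • Pi.single a 1) := by
        ext i j
        by_cases hi : i = a
        · subst hi; simp [haK]
        · simp [hA, hi]
      have hrow : (A K).updateRow a (M a) = A K := by
        ext i j
        by_cases hi : i = a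
        · subst hi; simp [hA, haK, ha]
        · simp [hi]
      have hunit : (A K).updateRow a (Pi.single a 1) = A (K.erase a) := by
        ext i j
        by_cases hi : i = a
        · subst hi; simp [hA]
        · simp [hA, hi]
      rw [hsplit, Matrix.det_updateRow_add, Matrix.det_updateRow_smul, hrow, hunit]
      exact add_pos_of_pos_of_nonneg (ih K) (mul_nonneg (hd a) (ih _).le)
    · convert ih K using 3
      funext i
      by_cases hi : i = a
      · subst hi; simp [haK]
      · simp [hi]

/-- A P-matrix does not reverse the sign of any nonzero vector. -/
theorem IsPMatrix.eq_zero_of_mul_mulVec_nonpos {ι : Type*} [Fintype ι] [DecidableEq ι]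
    {M : Matrix ι ι ℝ} (hM : IsPMatrix M) {x : ι → ℝ} (hx : ∀ i, x i * (M *ᵥ x) i ≤ 0) :
    x = 0 := by
  have hd : ∀ i, 0 ≤ -((M *ᵥ x) i / x i) := by
    intro i
    rw [neg_nonneg, div_eq_mul_inv, ← div_self_mul_self' (x i), mul_div_assoc', mul_comm]
    exact div_nonpos_of_nonpos_of_nonneg (hx i) (mul_self_nonneg _)
  refine Matrix.eq_zero_of_mulVec_eq_zero
    (hM.det_add_diagonal_pos hd Finset.univ (Finset.univ.filter fun i => x i ≠ 0)).ne' ?_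
  funext i
  by_cases hi : x i = 0
  · simp [Matrix.mulVec, hi]
  · have hrow : (M i - ((M *ᵥ x) i / x i) • Pi.single i 1) ⬝ᵥ x = 0 := by
      rw [sub_dotProduct, smul_dotProduct, single_dotProduct]
      change (M *ᵥ x) i - _ = 0
      rw [one_mul, smul_eq_mul, div_mul_cancel₀ _ hi, sub_self]
    refine Eq.trans (congrArg (· ⬝ᵥ x) ?_) hrow
    ext j
    simp [hi, sub_eq_add_neg]

theorem IsPMatrix.submatrix {ι κ : Type*} [Fintype ι] [DecidableEq ι] [Fintype κ] [DecidableEq κ]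
    {M : Matrix ι ι ℝ} (hM : IsPMatrix M) (e : κ ↪ ι) : IsPMatrix (M.submatrix e e) := by
  intro K
  have h := hM (K.map e)
  rw [← Matrix.det_submatrix_equiv_self (K.equivMap e)] at h
  simpa [Matrix.submatrix_submatrix, Function.comp_def] using h

theorem SolvesLCP.mul_eq_zero {ι : Type*} [Fintype ι] {M : Matrix ι ι ℝ} {q w z : ι → ℝ}
    (h : SolvesLCP M q w z) (i : ι) : w i * z i = 0 :=
  (Finset.sum_eq_zero_iff_of_nonneg fun i _ => mul_nonneg (h.2.1 i) (h.2.2.1 i)).1 h.2.2.2 i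
    (Finset.mem_univ i)

/-- The linear complementarity problem of a P-matrix has at most one solution. -/
theorem SolvesLCP.unique {ι : Type*} [Fintype ι] [DecidableEq ι] {M : Matrix ι ι ℝ}
    {q w z w' z' : ι → ℝ} (hM : IsPMatrix M) (h : SolvesLCP M q w z) (h' : SolvesLCP M q w' z') :
    z = z' := by
  refine sub_eq_zero.1 (hM.eq_zero_of_mul_mulVec_nonpos fun i => ?_)
  have e : w i - (M *ᵥ z) i = q i := congrFun h.1 i
  have e' : w' i - (M *ᵥ z') i = q i := congrFun h'.1 i
  have hdiff : (M *ᵥ (z - z')) i = w i - w' i := by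
    rw [Matrix.mulVec_sub, Pi.sub_apply]
    linarith
  rw [hdiff, Pi.sub_apply]
  nlinarith [h.mul_eq_zero i, h'.mul_eq_zero i, mul_nonneg (h.2.1 i) (h'.2.2.1 i),
    mul_nonneg (h'.2.1 i) (h.2.2.1 i)]

/-- Restricting a solution along `e` gives a solution of the principal subproblem when the
remaining columns do not contribute to its rows. -/
theorem SolvesLCP.restrict {ι κ : Type*} [Fintype ι] [Fintype κ] {M : Matrix ι ι ℝ}
    {q w z : ι → ℝ} (h : SolvesLCP M q w z) {e : κ → ι} (he : Function.Injective e)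
    (hz : ∀ i, ∀ j ∉ Set.range e, M (e i) j * z j = 0) :
    SolvesLCP (M.submatrix e e) (q ∘ e) (w ∘ e) (z ∘ e) := by
  refine ⟨?_, fun i => h.2.1 _, fun i => h.2.2.1 _,
    Finset.sum_eq_zero fun i _ => h.mul_eq_zero _⟩
  funext i
  have hsum : (M.submatrix e e *ᵥ (z ∘ e)) i = (M *ᵥ z) (e i) :=
    Fintype.sum_of_injective e he _ _ (hz i) fun j => rfl
  rw [Pi.sub_apply, hsum]
  exact congrFun h.1 (e i)

theorem Nondeg.add_ne_zero {ι : Type*} [Fintype ι] [DecidableEq ι] {M : Matrix ι ι ℝ}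
    {q w z : ι → ℝ} (hnd : Nondeg M q) (B : Finset ι) (hw : ∀ i ∈ B, w i = 0)
    (hz : ∀ i ∉ B, z i = 0) (h : w - M *ᵥ z = q) (i : ι) : w i + z i ≠ 0 := by
  have hB : basisMatrix M B *ᵥ (w + z) = q := by
    rw [← h]
    funext k
    have hk : w k = ∑ j, (1 : Matrix ι ι ℝ) k j * w j := by
      simpa [Matrix.mulVec, dotProduct] using (congrFun (Matrix.one_mulVec w) k).symm
    rw [Pi.sub_apply, hk]
    simp only [Matrix.mulVec, dotProduct, ← Finset.sum_sub_distrib]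
    refine Finset.sum_congr rfl fun j _ => ?_
    by_cases hj : j ∈ B
    · simp [basisMatrix, hj, hw j hj]
    · simp [basisMatrix, hj, hz j hj, Matrix.one_apply]
  have hunit : IsUnit (basisMatrix M B).det := by
    by_contra hdet
    exact hnd B i (by simp [Matrix.nonsing_inv_apply_not_isUnit _ hdet])
  have hinv : (basisMatrix M B)⁻¹ *ᵥ q = w + z := by
    rw [← hB, Matrix.mulVec_mulVec, Matrix.nonsing_inv_mul _ hunit, Matrix.one_mulVec]
  simpa [hinv] using hnd B i

/-- An optimal basis of a principal subproblem of a nondegenerate problem is the support of `z`. -/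
theorem OptimalBasis.mem_iff {ι κ : Type*} [Fintype ι] [DecidableEq ι] [Fintype κ] [DecidableEq κ]
    {M : Matrix ι ι ℝ} {q : ι → ℝ} (hnd : Nondeg M q) (e : κ ↪ ι) {B : Finset κ}
    (hB : OptimalBasis (M.submatrix e e) (q ∘ e) B) (i : κ) :
    i ∈ B ↔ zvec (M.submatrix e e) (q ∘ e) B i ≠ 0 := by
  refine ⟨fun hi => ?_, fun h => by by_contra hi; exact h (by simp [zvec, hi])⟩
  set z := zvec (M.submatrix e e) (q ∘ e) B with hzdef
  set z' := Function.extend e z 0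
  have hzz : ∀ j, z' (e j) = z j := fun j => e.injective.extend_apply _ _ j
  have hsub : ∀ j, (M *ᵥ z') (e j) = (M.submatrix e e *ᵥ z) j := fun j =>
    (Fintype.sum_of_injective e e.injective _ _
      (fun k hk => by simp [z', Function.extend_apply' _ _ _ hk])
      fun k => by simp [hzz]).symm
  have hw : ∀ j ∈ B, (q + M *ᵥ z') (e j) = 0 := by
    intro j hj
    have hj' := congrFun hB.1 j
    simp only [Pi.sub_apply, wvec, hj, if_true, Function.comp_apply] at hj'
    rw [Pi.add_apply, hsub, ← hj', zero_sub, neg_add_cancel]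
  have hne := hnd.add_ne_zero (w := q + M *ᵥ z') (z := z') (B.map e)
    (by
      intro k hk
      obtain ⟨j, hj, rfl⟩ := Finset.mem_map.1 hk
      exact hw j hj)
    (by
      intro k hk
      by_cases hr : ∃ j, e j = k
      · obtain ⟨j, rfl⟩ := hr
        rw [hzz]
        have hj : j ∉ B := fun hj => hk (Finset.mem_map_of_mem e hj)
        simp [hzdef, zvec, hj]
      · exact Function.extend_apply' _ _ _ hr)
    (add_sub_cancel_right _ _) (e i)
  rwa [hw i hi, zero_add, hzz] at hne


/-- dynamic programming recurrence for lower Hessenberg P-matrices.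
Here `Bf k hk` denotes the (unique) optimal basis `B(k)` of the leading
`k × k` subproblem, and the paper's index `ℓ ∈ {-1, 0, …, k-1}` is encoded as
`l = ℓ + 1 ∈ {0, 1, …, k}` (so `B(-1) = B(0) = ∅ = Bf 0`, using that
`l - 1` is truncated subtraction, and the paper's 1-based tail
`{ℓ+2, …, k}` is the set of 0-based indices `{i : l ≤ i}`). -/
theorem stmt_9 (n : ℕ) (M : Matrix (Fin n) (Fin n) ℝ) (q : Fin n → ℝ)
    (hM : IsPMatrix M) (hH : LowerHessenberg M) (hnd : Nondeg M q)
    (Bf : ∀ k : ℕ, k ≤ n → Finset (Fin k))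
    (hBf : ∀ (k : ℕ) (hk : k ≤ n),
      OptimalBasis (M.submatrix (Fin.castLE hk) (Fin.castLE hk))
        (fun j => q (Fin.castLE hk j)) (Bf k hk)) :
    ∀ (k : ℕ) (hk1 : 1 ≤ k) (hkn : k ≤ n),
      ∃ l : ℕ, ∃ hl : l ≤ k,
        Bf k hkn =
          (Bf (l - 1) (by omega)).image (Fin.castLE (by omega)) ∪
            Finset.univ.filter (fun i : Fin k => l ≤ (i : ℕ)) := by
  intro k hk1 hkn
  by_cases hall : ∀ i, i ∈ Bf k hkn
  · exact ⟨0, Nat.zero_le _, by ext i; simp [hall i]⟩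
  obtain ⟨p, hpB, hpmax⟩ := (Finset.univ.filter (· ∉ Bf k hkn)).exists_maximal
    (by push Not at hall; obtain ⟨i, hi⟩ := hall; exact ⟨i, by simp [hi]⟩)
  have hp : p ∉ Bf k hkn := by simpa using hpB
  have htail : ∀ i : Fin k, p < i → i ∈ Bf k hkn := by
    intro i hi
    by_contra hiB
    exact absurd (hpmax (by simp [hiB]) hi.le) (not_le.2 hi)
  have hpk : (p : ℕ) ≤ k := p.2.le
  have hrestrict := (hBf k hkn).restrict (Fin.castLE_injective hpk) (by
    intro i j hj
    rw [Set.mem_range] at hj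
    have hpj : p ≤ j := by
      by_contra h
      exact hj ⟨⟨j, not_le.1 h⟩, rfl⟩
    rcases hpj.eq_or_lt with rfl | hlt
    · simp [zvec, hp]
    · have hij : (i : ℕ) + 1 < j := lt_of_le_of_lt i.2 hlt
      rw [Matrix.submatrix_apply, hH _ _ hij, zero_mul])
  have hz := hrestrict.unique (hM.submatrix (Fin.castLEEmb (hpk.trans hkn)))
    (hBf p (hpk.trans hkn))
  have hhead : ∀ i : Fin p, Fin.castLE hpk i ∈ Bf k hkn ↔ i ∈ Bf p (hpk.trans hkn) := fun i =>
    (OptimalBasis.mem_iff hnd (Fin.castLEEmb hkn) (hBf k hkn) _).trans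
      ((not_congr (Eq.congr_left (congrFun hz i))).trans
        (OptimalBasis.mem_iff hnd (Fin.castLEEmb (hpk.trans hkn))
          (hBf p (hpk.trans hkn)) i).symm)
  refine ⟨p + 1, p.2, ?_⟩
  ext i
  simp only [Finset.mem_union, Finset.mem_image, Finset.mem_filter,
    Finset.mem_univ, true_and]
  rcases lt_trichotomy i p with hi | rfl | hi
  · refine ⟨fun h => Or.inl ⟨⟨i, hi⟩, (hhead ⟨i, hi⟩).1 h, rfl⟩, ?_⟩
    rintro (⟨j, hj, rfl⟩ | h)
    · exact (hhead j).2 hj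
    · exact absurd hi (not_lt.2 (Nat.le_of_succ_le h))
  · refine iff_of_false hp ?_
    rintro (⟨j, -, hj⟩ | h)
    · exact j.2.ne (congrArg Fin.val hj)
    · omega
  · exact iff_of_true (htail i hi) (Or.inr hi)
end
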